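/- Let h(t) = 2·K₀(t) − t·K₁(t) for t > 0. Then h(t) → +∞ as t → 0⁺, h(t) < 0 for all t ≥ 2, and consequently there exists t* ∈ (0, 2) with 2·K₀(t*) = t*·K₁(t*). (This is the high-wavenumber sign change of the tangential Modified Lighthill 1 eigenvalues.) -/

import Mathlib

open Filter

/-- Modified Bessel function of the second kind, order 0. -/
noncomputable def K0 (x : ℝ) : ℝ := ∫ t in Set.Ioi (0:ℝ), Real.exp (-x * Real.cosh t)

/-- Modified Bessel function of the second kind, order 1. -/
noncomputable def K1 (x : ℝ) : ℝ := ∫ t in Set.Ioi (0:ℝ), Real.exp (-x * Real.cosh t) * Real.cosh t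

open MeasureTheory Set in
lemma integrableOn_exp_neg_mul_cosh_mul_sinh {x : ℝ} (hx : 0 < x) :
    IntegrableOn (fun t => Real.exp (-x * Real.cosh t) * (x * Real.sinh t)) (Ioi 0) ∧
    ∫ t in Ioi (0:ℝ), Real.exp (-x * Real.cosh t) * (x * Real.sinh t) = Real.exp (-x) := by
  have hderiv : ∀ t ∈ Ici (0:ℝ), HasDerivAt (fun t => -Real.exp (-x * Real.cosh t))
      (Real.exp (-x * Real.cosh t) * (x * Real.sinh t)) t := by
    intro t _
    have h := (((Real.hasDerivAt_cosh t).const_mul (-x)).exp).neg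
    exact h.congr_deriv (by ring)
  have hnonneg : ∀ t ∈ Ioi (0:ℝ), 0 ≤ Real.exp (-x * Real.cosh t) * (x * Real.sinh t) := by
    intro t ht
    have := Real.sinh_nonneg_iff.2 (le_of_lt ht)
    positivity
  have hcosh : Tendsto Real.cosh atTop atTop := by
    refine tendsto_atTop_mono (fun t => ?_)
      (Real.tendsto_exp_atTop.atTop_mul_const (by norm_num : (0:ℝ) < 1 / 2))
    rw [Real.cosh_eq]
    linarith [Real.exp_pos (-t)]
  have hlim : Tendsto (fun t => -Real.exp (-x * Real.cosh t)) atTop (nhds 0) := by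
    have h := Real.tendsto_exp_atBot.comp
      (hcosh.const_mul_atTop_of_neg (neg_lt_zero.2 hx))
    simpa using h.neg
  refine ⟨integrableOn_Ioi_deriv_of_nonneg' hderiv hnonneg hlim, ?_⟩
  rw [integral_Ioi_of_hasDerivAt_of_nonneg' hderiv hnonneg hlim]
  simp

open MeasureTheory Set in
lemma integrableOn_exp_neg_mul_cosh_mul_cosh {x : ℝ} (hx : 0 < x) :
    IntegrableOn (fun t => Real.exp (-x * Real.cosh t) * Real.cosh t) (Ioi 0) := by
  have h := ((integrableOn_exp_neg_mul_cosh_mul_sinh hx).1.const_mul x⁻¹).add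
    (integrableOn_exp_neg_Ioi 0)
  refine Integrable.mono' h (by fun_prop) (ae_of_all _ fun t => ?_)
  have h1 : Real.exp (-x * Real.cosh t) ≤ 1 :=
    Real.exp_le_one_iff.2 (by nlinarith [Real.cosh_pos t])
  have h2 := Real.cosh_sub_sinh t
  have h3 := Real.exp_pos (-t)
  have h4 := Real.cosh_pos t
  rw [Real.norm_of_nonneg (by positivity)]
  simp only [Pi.add_apply]
  have h5 : x⁻¹ * (Real.exp (-x * Real.cosh t) * (x * Real.sinh t)) =
      Real.exp (-x * Real.cosh t) * Real.sinh t := by field_simp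
  rw [h5]
  nlinarith

open MeasureTheory Set in
lemma integrableOn_exp_neg_mul_cosh {x : ℝ} (hx : 0 < x) :
    IntegrableOn (fun t => Real.exp (-x * Real.cosh t)) (Ioi 0) := by
  refine Integrable.mono' (integrableOn_exp_neg_mul_cosh_mul_cosh hx) (by fun_prop)
    (ae_of_all _ fun t => ?_)
  rw [Real.norm_of_nonneg (Real.exp_pos _).le]
  exact le_mul_of_one_le_right (Real.exp_pos _).le (Real.one_le_cosh t)

open MeasureTheory Set in
lemma mul_K1_le {x : ℝ} (hx : 0 < x) : x * K1 x ≤ 1 + x := by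
  obtain ⟨hi, he⟩ := integrableOn_exp_neg_mul_cosh_mul_sinh hx
  have hexp := (integrableOn_exp_neg_Ioi 0).const_mul x
  have hle : x * K1 x ≤ ∫ t in Ioi (0:ℝ),
      (Real.exp (-x * Real.cosh t) * (x * Real.sinh t) + x * Real.exp (-t)) := by
    rw [K1, ← integral_const_mul]
    refine integral_mono ((integrableOn_exp_neg_mul_cosh_mul_cosh hx).const_mul x)
      (hi.add hexp) fun t => ?_
    have h1 : Real.exp (-x * Real.cosh t) ≤ 1 :=
      Real.exp_le_one_iff.2 (by nlinarith [Real.cosh_pos t])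
    have h2 : Real.cosh t = Real.sinh t + Real.exp (-t) := by
      linarith [Real.cosh_sub_sinh t]
    have h3 : Real.exp (-x * Real.cosh t) * (x * Real.exp (-t)) ≤ x * Real.exp (-t) :=
      mul_le_of_le_one_left (by positivity) h1
    have h4 : x * (Real.exp (-x * Real.cosh t) * Real.cosh t) =
        Real.exp (-x * Real.cosh t) * (x * Real.sinh t) +
        Real.exp (-x * Real.cosh t) * (x * Real.exp (-t)) := by
      linear_combination x * Real.exp (-x * Real.cosh t) * h2
    change x * (Real.exp (-x * Real.cosh t) * Real.cosh t) ≤ _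
    linarith
  rw [integral_add hi hexp, he, integral_const_mul, integral_exp_neg_Ioi_zero] at hle
  have : Real.exp (-x) ≤ 1 := Real.exp_le_one_iff.2 (by linarith)
  linarith

open MeasureTheory Set in
lemma mul_exp_neg_mul_cosh_le_K0 {x T : ℝ} (hx : 0 < x) (hT : 0 ≤ T) :
    T * Real.exp (-x * Real.cosh T) ≤ K0 x := by
  have hi := integrableOn_exp_neg_mul_cosh hx
  have hsub : Ioc 0 T ⊆ Ioi (0:ℝ) := Ioc_subset_Ioi_self
  calc T * Real.exp (-x * Real.cosh T)
      = ∫ _ in Ioc 0 T, Real.exp (-x * Real.cosh T) := by simp [hT]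
    _ ≤ ∫ t in Ioc 0 T, Real.exp (-x * Real.cosh t) := by
        refine setIntegral_mono_on (by simp) (hi.mono_set hsub) measurableSet_Ioc
          fun t ht => Real.exp_le_exp.2 ?_
        have : Real.cosh t ≤ Real.cosh T :=
          Real.cosh_le_cosh.2 (by rw [abs_of_pos ht.1, abs_of_nonneg hT]; exact ht.2)
        nlinarith
    _ ≤ K0 x := setIntegral_mono_set hi (ae_of_all _ fun t => (Real.exp_pos _).le)
        hsub.eventuallyLE

lemma tendsto_K0_nhdsGT_zero : Tendsto K0 (nhdsWithin 0 (Set.Ioi 0)) atTop := by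
  refine tendsto_atTop.2 fun M => ?_
  set T := |M| * Real.exp 1
  have hT : 0 ≤ T := by positivity
  have hc := Real.cosh_pos T
  filter_upwards [Ioo_mem_nhdsGT (inv_pos.2 hc)] with x hx
  have hxc : x * Real.cosh T ≤ 1 := by
    calc x * Real.cosh T ≤ (Real.cosh T)⁻¹ * Real.cosh T := by gcongr; exact hx.2.le
      _ = 1 := inv_mul_cancel₀ hc.ne'
  calc M ≤ |M| := le_abs_self M
    _ = T * Real.exp (-1) := by rw [mul_assoc, ← Real.exp_add]; simp
    _ ≤ T * Real.exp (-x * Real.cosh T) := by gcongr; linarith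
    _ ≤ K0 x := mul_exp_neg_mul_cosh_le_K0 hx.1 hT

open MeasureTheory Set in
lemma continuousAt_K0 {x : ℝ} (hx : 0 < x) : ContinuousAt K0 x := by
  refine continuousAt_of_dominated (Eventually.of_forall fun y => by fun_prop) ?_
    (integrableOn_exp_neg_mul_cosh (half_pos hx)) (ae_of_all _ fun t => by fun_prop)
  filter_upwards [Ioi_mem_nhds (half_lt_self hx)] with y hy
  refine ae_of_all _ fun t => ?_
  rw [Real.norm_of_nonneg (Real.exp_pos _).le]
  exact Real.exp_le_exp.2 (mul_le_mul_of_nonneg_right (neg_le_neg (le_of_lt hy))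
    (Real.cosh_pos t).le)

open MeasureTheory Set in
lemma continuousAt_K1 {x : ℝ} (hx : 0 < x) : ContinuousAt K1 x := by
  refine continuousAt_of_dominated (Eventually.of_forall fun y => by fun_prop) ?_
    (integrableOn_exp_neg_mul_cosh_mul_cosh (half_pos hx)) (ae_of_all _ fun t => by fun_prop)
  filter_upwards [Ioi_mem_nhds (half_lt_self hx)] with y hy
  refine ae_of_all _ fun t => ?_
  have hc := Real.cosh_pos t
  rw [Real.norm_of_nonneg (by positivity)]
  exact mul_le_mul_of_nonneg_right (Real.exp_le_exp.2
    (mul_le_mul_of_nonneg_right (neg_le_neg (le_of_lt hy)) hc.le)) hc.le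

open MeasureTheory Set in
lemma two_mul_K0_lt_mul_K1 {x : ℝ} (hx : 2 ≤ x) : 2 * K0 x < x * K1 x := by
  have hx0 : 0 < x := by linarith
  have h0 := (integrableOn_exp_neg_mul_cosh hx0).const_mul 2
  have h1 := (integrableOn_exp_neg_mul_cosh_mul_cosh hx0).const_mul x
  have hpos : ∀ t ∈ Ioi (0:ℝ), 0 < x * (Real.exp (-x * Real.cosh t) * Real.cosh t) -
      2 * Real.exp (-x * Real.cosh t) := by
    intro t ht
    have hc : 1 < Real.cosh t := Real.one_lt_cosh.2 (ne_of_gt ht)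
    have : 0 < Real.exp (-x * Real.cosh t) * (x * Real.cosh t - 2) :=
      mul_pos (Real.exp_pos _) (by nlinarith)
    linarith
  have hint : 0 < ∫ t in Ioi (0:ℝ), (x * (Real.exp (-x * Real.cosh t) * Real.cosh t) -
      2 * Real.exp (-x * Real.cosh t)) := by
    rw [setIntegral_pos_iff_support_of_nonneg_ae
      ((ae_restrict_mem measurableSet_Ioi).mono fun t ht => (hpos t ht).le) (h1.sub h0),
      inter_eq_right.2 fun t ht => Function.mem_support.2 (hpos t ht).ne']
    simp
  rw [integral_sub h1 h0, integral_const_mul, integral_const_mul] at hint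
  exact sub_pos.1 hint

/-- The function `h(t) = 2K₀(t) − t K₁(t)` tends to `+∞` as `t → 0⁺`, is negative for `t ≥ 2`,
and hence has a zero `t* ∈ (0,2)`: the high-wavenumber sign change of the tangential
Modified Lighthill 1 eigenvalues. -/
theorem modified_lighthill_sign_change :
    Tendsto (fun t : ℝ => 2 * K0 t - t * K1 t) (nhdsWithin 0 (Set.Ioi 0)) atTop ∧
    (∀ t : ℝ, 2 ≤ t → 2 * K0 t - t * K1 t < 0) ∧
    (∃ t : ℝ, t ∈ Set.Ioo (0:ℝ) 2 ∧ 2 * K0 t = t * K1 t) := by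
  have hlim : Tendsto (fun t : ℝ => 2 * K0 t - t * K1 t) (nhdsWithin 0 (Set.Ioi 0)) atTop := by
    have h : Tendsto (fun t => 2 * K0 t + -2) (nhdsWithin 0 (Set.Ioi 0)) atTop :=
      tendsto_atTop_add_const_right _ _ (tendsto_K0_nhdsGT_zero.const_mul_atTop two_pos)
    refine tendsto_atTop_mono' _ ?_ h
    filter_upwards [Ioo_mem_nhdsGT one_pos] with t ht
    linarith [mul_K1_le ht.1, ht.2]
  refine ⟨hlim, fun t ht => sub_neg.2 (two_mul_K0_lt_mul_K1 ht), ?_⟩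
  obtain ⟨a, ha, ha2⟩ :=
    ((hlim.eventually_gt_atTop 0).and (Ioo_mem_nhdsGT (two_pos (α := ℝ)))).exists
  have hcont : ContinuousOn (fun t : ℝ => 2 * K0 t - t * K1 t) (Set.Icc a 2) := by
    intro t ht
    have ht0 : 0 < t := ha2.1.trans_le ht.1
    exact ((continuousAt_const.mul (continuousAt_K0 ht0)).sub
      (continuousAt_id.mul (continuousAt_K1 ht0))).continuousWithinAt
  obtain ⟨t, ht, hzero⟩ := intermediate_value_Ioo' ha2.2.le hcont
    ⟨sub_neg.2 (two_mul_K0_lt_mul_K1 le_rfl), ha⟩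
  exact ⟨t, ⟨ha2.1.trans ht.1, ht.2⟩, sub_eq_zero.1 hzero⟩
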